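/- Let n ≥ 2, let y : Fin n → Bool be labels, let P = {(i,j) : i ≠ j} be the set of ordered pairs with N = n(n−1) = |P|, let O = {(i,j) ∈ P : y i ≠ y j} be the set of opposite-label pairs with K = |O|, and let v : P → ℝ^d satisfy v(p) = 0 for every p ∈ P \ O. Set μ = N⁻¹ Σ_{p ∈ P} v(p). If K < N and Σ_{p ∈ O} ‖v(p)‖² > 0, then K⁻¹ Σ_{p ∈ O} ‖(K/N)·v(p) − μ‖² < N⁻¹ Σ_{p ∈ P} ‖v(p) − μ‖²; that is, the variance of the importance-weighted stochastic gradient sampled uniformly from opposite-label pairs is strictly smaller than the variance of the stochastic gradient sampled uniformly from all pairs. -/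

import Mathlib

open scoped InnerProductSpace in
/-- The variance of a finite family of vectors is its mean squared norm minus the squared norm of
its mean. -/
theorem inv_card_mul_sum_norm_sub_mean_sq {ι E : Type*} [NormedAddCommGroup E]
    [InnerProductSpace ℝ E] {s : Finset ι} (hs : s.Nonempty) (f : ι → E) {m : E}
    (hm : m = (s.card : ℝ)⁻¹ • ∑ i ∈ s, f i) :
    (s.card : ℝ)⁻¹ * ∑ i ∈ s, ‖f i - m‖ ^ 2
      = (s.card : ℝ)⁻¹ * ∑ i ∈ s, ‖f i‖ ^ 2 - ‖m‖ ^ 2 := by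
  have hc : (s.card : ℝ) ≠ 0 := Nat.cast_ne_zero.mpr hs.card_ne_zero
  have hsum : ∑ i ∈ s, f i = (s.card : ℝ) • m := by rw [hm, smul_inv_smul₀ hc]
  have hinner : ∑ i ∈ s, ⟪f i, m⟫_ℝ = s.card * ‖m‖ ^ 2 := by
    rw [← sum_inner, hsum, real_inner_smul_left, real_inner_self_eq_norm_sq]
  simp only [norm_sub_sq_real, Finset.sum_add_distrib, Finset.sum_sub_distrib, ← Finset.mul_sum,
    hinner, Finset.sum_const, nsmul_eq_mul]
  field_simp
  ring

/-- Proposition 1 (variance reduction by opposite-pair sampling): the variance of the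
importance-weighted stochastic gradient sampled uniformly from opposite-label pairs is
strictly smaller than the variance of the stochastic gradient sampled uniformly over
all ordered pairs of distinct indices. -/
theorem stmt_3 (n d : ℕ) (hn : 2 ≤ n) (y : Fin n → Bool)
    (P O : Finset (Fin n × Fin n))
    (hP : P = Finset.univ.filter (fun p => p.1 ≠ p.2))
    (hO : O = P.filter (fun p => y p.1 ≠ y p.2))
    (N K : ℕ) (hN : N = P.card) (hNval : N = n * (n - 1)) (hK : K = O.card)
    (v : Fin n × Fin n → EuclideanSpace ℝ (Fin d))
    (hv : ∀ p ∈ P \ O, v p = 0)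
    (μ : EuclideanSpace ℝ (Fin d)) (hμ : μ = (N : ℝ)⁻¹ • ∑ p ∈ P, v p)
    (hKN : K < N) (hpos : 0 < ∑ p ∈ O, ‖v p‖ ^ 2) :
    (K : ℝ)⁻¹ * ∑ p ∈ O, ‖((K : ℝ) / (N : ℝ)) • v p - μ‖ ^ 2
      < (N : ℝ)⁻¹ * ∑ p ∈ P, ‖v p - μ‖ ^ 2 := by
  have hOP : O ⊆ P := hO ▸ Finset.filter_subset _ _
  have hOne : O.Nonempty := by
    rw [Finset.nonempty_iff_ne_empty]
    rintro h
    simp [h] at hpos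
  have hK0 : (0 : ℝ) < K := by
    rw [hK]
    exact_mod_cast hOne.card_pos
  have hKN' : (K : ℝ) < N := by exact_mod_cast hKN
  have hN0 : (0 : ℝ) < N := hK0.trans hKN'
  have hv' : ∀ p ∈ P, p ∉ O → v p = 0 := fun p hp hpO => hv p (Finset.mem_sdiff.mpr ⟨hp, hpO⟩)
  have hsum : ∑ p ∈ O, v p = ∑ p ∈ P, v p := Finset.sum_subset hOP hv'
  have hsq : ∑ p ∈ O, ‖v p‖ ^ 2 = ∑ p ∈ P, ‖v p‖ ^ 2 :=
    Finset.sum_subset hOP fun p hp hpO => by simp [hv' p hp hpO]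
  have hμO : μ = (K : ℝ)⁻¹ • ∑ p ∈ O, ((K : ℝ) / N) • v p := by
    rw [← Finset.smul_sum, smul_smul, hsum, hμ]
    congr 1
    field_simp
  have hvarP := inv_card_mul_sum_norm_sub_mean_sq (hOne.mono hOP) v (hN ▸ hμ)
  have hvarO := inv_card_mul_sum_norm_sub_mean_sq hOne (fun p => ((K : ℝ) / N) • v p)
    (m := μ) (by rw [← hK]; exact hμO)
  rw [← hN] at hvarP
  rw [← hK] at hvarO
  have hscaled : ∑ p ∈ O, ‖((K : ℝ) / N) • v p‖ ^ 2
      = ((K : ℝ) / N) ^ 2 * ∑ p ∈ O, ‖v p‖ ^ 2 := by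
    simp only [norm_smul, mul_pow, Real.norm_eq_abs, sq_abs, Finset.mul_sum]
  rw [hvarP, hvarO, hscaled, ← hsq, ← mul_assoc]
  gcongr
  calc (K : ℝ)⁻¹ * ((K : ℝ) / N) ^ 2 = (K / N) * (N : ℝ)⁻¹ := by field_simp
    _ < 1 * (N : ℝ)⁻¹ := by
      gcongr
      exact (div_lt_one hN0).mpr hKN'
    _ = (N : ℝ)⁻¹ := one_mul _
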